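/- Let σ > 0, Δ ≥ 0, and let μ, ν ∈ ℝ satisfy |μ − ν| ≤ Δ. Let p_μ and p_ν denote the probability density functions of the real Gaussian distributions N(μ, σ²) and N(ν, σ²). Then for every real α > 1, ∫_ℝ (p_μ x)^α · (p_ν x)^{1−α} dx ≤ exp( α(α−1)·ρ ) where ρ = Δ²/(2σ²). (This is the zCDP guarantee of the Gaussian mechanism: adding N(0, σ²) noise to a real-valued function of sensitivity Δ satisfies Δ²/(2σ²)-zCDP.) -/

import Mathlib

open Real

/-- The probability density function of the real Gaussian distribution `N(μ, σ²)`. -/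
noncomputable def gaussPDF (μ σ x : ℝ) : ℝ :=
  (1 / (σ * Real.sqrt (2 * Real.pi))) * Real.exp (-((x - μ) ^ 2) / (2 * σ ^ 2))

theorem gaussPDF_eq_gaussianPDFReal (μ : ℝ) {σ : ℝ} (hσ : 0 < σ) :
    gaussPDF μ σ = ProbabilityTheory.gaussianPDFReal μ (σ ^ 2).toNNReal := by
  ext x
  rw [gaussPDF, ProbabilityTheory.gaussianPDFReal, Real.coe_toNNReal _ (sq_nonneg σ),
    Real.sqrt_mul (by positivity) (σ ^ 2), Real.sqrt_sq hσ.le, one_div,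
    mul_comm σ (√(2 * π))]

theorem integral_gaussPDF_eq_one (μ : ℝ) {σ : ℝ} (hσ : 0 < σ) :
    ∫ x, gaussPDF μ σ x = 1 := by
  rw [gaussPDF_eq_gaussianPDFReal μ hσ]
  exact ProbabilityTheory.integral_gaussianPDFReal_eq_one μ
    (Real.toNNReal_pos.mpr (by positivity)).ne'

/-- A log-affine combination of two Gaussian densities with equal variance is a multiple of the
Gaussian density centred at the affine combination of the means. -/
theorem gaussPDF_rpow_mul_gaussPDF_rpow {σ : ℝ} (hσ : 0 < σ) (μ ν α x : ℝ) :
    gaussPDF μ σ x ^ α * gaussPDF ν σ x ^ (1 - α) =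
      exp (α * (α - 1) * ((μ - ν) ^ 2 / (2 * σ ^ 2))) *
        gaussPDF (α * μ + (1 - α) * ν) σ x := by
  have hc : 0 < 1 / (σ * √(2 * π)) := by positivity
  simp only [gaussPDF]
  rw [mul_rpow hc.le (exp_pos _).le, mul_rpow hc.le (exp_pos _).le, ← exp_mul, ← exp_mul,
    mul_mul_mul_comm, ← rpow_add hc, ← exp_add, add_sub_cancel, rpow_one, mul_left_comm,
    ← exp_add]
  congr 2
  field_simp
  ring

/-- The Rényi moment of two Gaussian densities with equal variance. -/
theorem integral_gaussPDF_rpow_mul_gaussPDF_rpow {σ : ℝ} (hσ : 0 < σ) (μ ν α : ℝ) :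
    ∫ x, gaussPDF μ σ x ^ α * gaussPDF ν σ x ^ (1 - α) =
      exp (α * (α - 1) * ((μ - ν) ^ 2 / (2 * σ ^ 2))) := by
  simp_rw [gaussPDF_rpow_mul_gaussPDF_rpow hσ]
  rw [MeasureTheory.integral_const_mul, integral_gaussPDF_eq_one _ hσ, mul_one]

/-- zCDP guarantee of the Gaussian mechanism: if `|μ - ν| ≤ Δ` then for
every `α > 1`, `∫ p_μ^α p_ν^{1-α} ≤ exp(α(α-1)ρ)` with `ρ = Δ²/(2σ²)`. -/
theorem gaussian_mechanism_zCDP (σ Δ μ ν : ℝ) (hσ : 0 < σ) (hΔ : 0 ≤ Δ)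
    (hsens : |μ - ν| ≤ Δ) :
    ∀ α : ℝ, 1 < α →
      ∫ x : ℝ, (gaussPDF μ σ x) ^ α * (gaussPDF ν σ x) ^ (1 - α)
        ≤ Real.exp (α * (α - 1) * (Δ ^ 2 / (2 * σ ^ 2))) := by
  intro α hα
  rw [integral_gaussPDF_rpow_mul_gaussPDF_rpow hσ]
  have hsq : (μ - ν) ^ 2 ≤ Δ ^ 2 := sq_le_sq' (abs_le.mp hsens).1 (abs_le.mp hsens).2
  have hα' : 0 ≤ α * (α - 1) := mul_nonneg (by linarith) (by linarith)
  gcongr
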